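/- Let H = (V, E) be a hypergraph, ω ∈ [2,3], γ := ω − 2, and fix subsets U_ℓ ⊆ V for ℓ ∈ [L] and pairwise-disjoint subsets X_j, Y_j, Z_j, G_j ⊆ V for j ∈ [J], with L + J ≥ 1. Let opt be the supremum of t over all pairs (t, h) where h is an edge-dominated polymatroid on V, t ∈ ℝ, t ≤ h(U_ℓ) for every ℓ ∈ [L], and t ≤ h(X_j|G_j) + h(Y_j|G_j) + γ·h(Z_j|G_j) + h(G_j) for every j ∈ [J]. Then there exists an ω-Shannon inequality over V, of the form Σ_{ℓ∈[L]} λ_ℓ·h(U_ℓ) + Σ_{j∈[J]} ( α_j·h(X_j|G_j) + β_j·h(Y_j|G_j) + ζ_j·h(Z_j|G_j) + κ_j·h(G_j) ) ≤ Σ_{i∈[I]} w_i·h(Y_i|X_i) (allowing some κ_j = 0 with the corresponding α_j = β_j = ζ_j = 0, i.e., the j-th group dropped), such that: for each i ∈ [I], X_i = ∅ and Y_i ∈ E; for each j ∈ [J] with κ_j > 0, α_j = β_j = κ_j and ζ_j = κ_j·γ; Σ_ℓ λ_ℓ + Σ_j κ_j > 0; and (Σ_i w_i)/(Σ_ℓ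 λ_ℓ + Σ_j κ_j) = opt. Moreover, if ω is rational, the inequality can be chosen to be integral. -/

import Mathlib

open Finset

/-- A polymatroid on a finite vertex type `V`. -/
def IsPolymatroid {V : Type*} [DecidableEq V] [Fintype V] (h : Finset V → ℝ) : Prop :=
  h ∅ = 0 ∧ (∀ A : Finset V, 0 ≤ h A) ∧
    (∀ A B : Finset V, A ⊆ B → h A ≤ h B) ∧
    (∀ A B : Finset V, h (A ∪ B) + h (A ∩ B) ≤ h A + h B)

/-- The conditional term `h(Y|X) = h(X ∪ Y) − h(X)`. -/
noncomputable def condH {V : Type*} [DecidableEq V]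
    (h : Finset V → ℝ) (Y X : Finset V) : ℝ :=
  h (X ∪ Y) - h X

/-- The conditional mutual-information term
`h(Y;Z|X) = h(X∪Y) + h(X∪Z) − h(X) − h(X∪Y∪Z)`. -/
noncomputable def condMI {V : Type*} [DecidableEq V]
    (h : Finset V → ℝ) (Y Z X : Finset V) : ℝ :=
  h (X ∪ Y) + h (X ∪ Z) - h X - h (X ∪ Y ∪ Z)

/-- The Farkas lemma (inductive proof of Bartl). -/
theorem farkas_aux {W ι : Type*} [AddCommGroup W] [Module ℝ W] [DecidableEq ι] (S : Finset ι) :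
    ∀ (a : ι → W →ₗ[ℝ] ℝ) (b : W →ₗ[ℝ] ℝ),
      (∀ x, (∀ i ∈ S, 0 ≤ a i x) → 0 ≤ b x) →
      ∃ c : ι → ℝ, (∀ i, 0 ≤ c i) ∧ ∀ x, b x = ∑ i ∈ S, c i * a i x := by
  induction S using Finset.induction_on with
  | empty =>
    intro a b hb
    refine ⟨fun _ => 0, fun _ => le_rfl, fun x => ?_⟩
    have h1 := hb x (by simp)
    have h2 := hb (-x) (by simp)
    rw [map_neg] at h2
    simp only [Finset.sum_empty]
    linarith
  | insert k S hk ih =>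
    intro a b hb
    by_cases hS : ∀ x, (∀ i ∈ S, 0 ≤ a i x) → 0 ≤ b x
    · obtain ⟨c, hc, hbc⟩ := ih a b hS
      refine ⟨fun i => if i = k then 0 else c i, fun i => ?_, fun x => ?_⟩
      · dsimp only
        split_ifs
        · exact le_rfl
        · exact hc i
      · rw [Finset.sum_insert hk, hbc x]
        simp only [if_true, zero_mul, zero_add]
        refine Finset.sum_congr rfl fun i hi => ?_
        rw [if_neg (fun h : i = k => hk (h ▸ hi))]
    · push Not at hS
      obtain ⟨y, hy, hby⟩ := hS
      have hky : a k y < 0 := by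
        by_contra hcon
        push Not at hcon
        have := hb y (by
          intro i hi
          rcases Finset.mem_insert.1 hi with rfl | hi
          · exact hcon
          · exact hy i hi)
        linarith
      obtain ⟨x0, hx0, hbx0, hkx0⟩ : ∃ x0, (∀ i ∈ S, 0 ≤ a i x0) ∧ b x0 < 0 ∧ a k x0 = -1 := by
        have hr : 0 < (-(a k y))⁻¹ := inv_pos.2 (by linarith)
        refine ⟨(-(a k y))⁻¹ • y, fun i hi => ?_, ?_, ?_⟩
        · rw [map_smul, smul_eq_mul]
          exact mul_nonneg hr.le (hy i hi)
        · rw [map_smul, smul_eq_mul]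
          exact mul_neg_of_pos_of_neg hr hby
        · rw [map_smul, smul_eq_mul]
          have : a k y ≠ 0 := hky.ne
          field_simp
      obtain ⟨c, hc, hbc⟩ := ih (fun i => a i + (a i x0) • a k) (b + (b x0) • a k) (by
        intro x hx
        have := hb (x + (a k x) • x0) (by
          intro i hi
          rcases Finset.mem_insert.1 hi with rfl | hi
          · simp [hkx0]
          · have := hx i hi
            simp only [LinearMap.add_apply, LinearMap.smul_apply, smul_eq_mul, map_add,
              map_smul] at this ⊢
            linarith)
        simp only [LinearMap.add_apply, LinearMap.smul_apply, smul_eq_mul, map_add,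
          map_smul] at this ⊢
        linarith)
      refine ⟨fun i => if i = k then (∑ i ∈ S, c i * a i x0) - b x0 else c i,
        fun i => ?_, fun x => ?_⟩
      · dsimp only
        split_ifs
        · have := Finset.sum_nonneg (fun i hi => mul_nonneg (hc i) (hx0 i hi))
          linarith
        · exact hc i
      · have h1 := hbc x
        simp only [LinearMap.add_apply, LinearMap.smul_apply, smul_eq_mul] at h1
        rw [Finset.sum_insert hk]
        simp only [if_true]
        have h2 : ∑ i ∈ S, (if i = k then (∑ i ∈ S, c i * a i x0) - b x0 else c i) * a i x
            = ∑ i ∈ S, c i * a i x := by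
          refine Finset.sum_congr rfl fun i hi => ?_
          rw [if_neg (fun h : i = k => hk (h ▸ hi))]
        rw [h2]
        have h3 : ∑ i ∈ S, c i * (a i x + a i x0 * a k x)
            = ∑ i ∈ S, c i * a i x + (∑ i ∈ S, c i * a i x0) * a k x := by
          rw [Finset.sum_mul, ← Finset.sum_add_distrib]
          exact Finset.sum_congr rfl fun i _ => by ring
        rw [h3] at h1
        linarith

/-- Rational approximation of a real vector respecting all rational linear relations. -/
theorem rational_approx {ι : Type*} [Fintype ι] (c : ι → ℝ) (ε : ℝ) (hε : 0 < ε) :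
    ∃ q : ι → ℚ, (∀ i, |(q i : ℝ) - c i| < ε) ∧ (∀ i, c i = 0 → q i = 0) ∧
      ∀ a : ι → ℚ, ∑ i, c i * (a i : ℝ) = 0 → ∑ i, q i * a i = 0 := by
  classical
  let M : Submodule ℚ ℝ := Submodule.span ℚ (Set.range c)
  have : Module.Finite ℚ M := Module.Finite.span_of_finite ℚ (Set.finite_range c)
  let B := Module.finBasis ℚ M
  let cm : ι → M := fun i => ⟨c i, Submodule.subset_span ⟨i, rfl⟩⟩
  let N : ℝ := ∑ i, ∑ k, |((B.repr (cm i) k : ℚ) : ℝ)|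
  have hN : 0 ≤ N := Finset.sum_nonneg fun i _ => Finset.sum_nonneg fun k _ => abs_nonneg _
  have hδ : 0 < ε / (N + 1) := div_pos hε (by linarith)
  have hex : ∀ k, ∃ r : ℚ, |(r : ℝ) - (B k : ℝ)| < ε / (N + 1) := by
    intro k
    obtain ⟨r, h1, h2⟩ := exists_rat_btwn (show (B k : ℝ) < B k + ε / (N + 1) by linarith)
    exact ⟨r, by rw [abs_lt]; constructor <;> linarith⟩
  choose r hr using hex
  let φ : M →ₗ[ℚ] ℚ := B.constr ℚ r
  have hφ : ∀ i, φ (cm i) = ∑ k, B.repr (cm i) k * r k := by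
    intro i
    simp [φ, Module.Basis.constr_apply_fintype, Module.Basis.equivFun_apply]
  have hci : ∀ i, c i = ∑ k, ((B.repr (cm i) k : ℚ) : ℝ) * (B k : ℝ) := by
    intro i
    have h := congrArg (Subtype.val) (B.sum_repr (cm i))
    rw [Submodule.coe_sum] at h
    simp only [Submodule.coe_smul, Rat.smul_def] at h
    exact h.symm
  refine ⟨fun i => φ (cm i), fun i => ?_, fun i hi => ?_, fun a ha => ?_⟩
  · have h1 : (φ (cm i) : ℝ) - c i
        = ∑ k, ((B.repr (cm i) k : ℚ) : ℝ) * ((r k : ℝ) - (B k : ℝ)) := by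
      rw [hφ i]
      conv_lhs => rw [hci i]
      push_cast
      rw [← Finset.sum_sub_distrib]
      exact Finset.sum_congr rfl fun k _ => by ring
    rw [h1]
    calc _ ≤ ∑ k, |((B.repr (cm i) k : ℚ) : ℝ) * ((r k : ℝ) - (B k : ℝ))| :=
          Finset.abs_sum_le_sum_abs _ _
      _ ≤ ∑ k, |((B.repr (cm i) k : ℚ) : ℝ)| * (ε / (N + 1)) := by
          refine Finset.sum_le_sum fun k _ => ?_
          rw [abs_mul]
          exact mul_le_mul_of_nonneg_left (hr k).le (abs_nonneg _)
      _ = (∑ k, |((B.repr (cm i) k : ℚ) : ℝ)|) * (ε / (N + 1)) := by rw [Finset.sum_mul]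
      _ ≤ N * (ε / (N + 1)) := by
          refine mul_le_mul_of_nonneg_right ?_ hδ.le
          exact Finset.single_le_sum
            (f := fun i => ∑ k, |((B.repr (cm i) k : ℚ) : ℝ)|)
            (fun i _ => Finset.sum_nonneg fun k _ => abs_nonneg _) (Finset.mem_univ i)
      _ < ε := by
          rw [mul_div_assoc', div_lt_iff₀ (by linarith)]
          nlinarith
  · have : cm i = 0 := Subtype.ext hi
    simp [this]
  · have h0 : ∑ i, a i • cm i = 0 := by
      apply Subtype.ext
      rw [Submodule.coe_sum]
      simp only [Submodule.coe_smul, Rat.smul_def, Submodule.coe_zero]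
      rw [← ha]
      exact Finset.sum_congr rfl fun i _ => mul_comm _ _
    have h1 := congrArg φ h0
    rw [map_sum, map_zero] at h1
    rw [← h1]
    exact Finset.sum_congr rfl fun i _ => by rw [map_smul, smul_eq_mul, mul_comm]

/-- Natural-number vector respecting the rational relations, below the real one after scaling. -/
theorem nat_approx {ι : Type*} [Fintype ι] (c : ι → ℝ) (hc : ∀ i, 0 ≤ c i) :
    ∃ (D : ℕ) (n : ι → ℕ), 0 < D ∧ (∀ i, (n i : ℝ) ≤ 2 * (D * c i)) ∧
      (∀ i, 0 < c i → 0 < n i) ∧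
      ∀ a : ι → ℚ, ∑ i, c i * (a i : ℝ) = 0 → ∑ i, (n i : ℝ) * (a i : ℝ) = 0 := by
  classical
  obtain ⟨ε, hε, hεc⟩ : ∃ ε : ℝ, 0 < ε ∧ ∀ i, 0 < c i → ε ≤ c i := by
    have : ∀ S : Finset ι, ∃ ε : ℝ, 0 < ε ∧ ∀ i ∈ S, 0 < c i → ε ≤ c i := by
      intro S
      induction S using Finset.induction_on with
      | empty => exact ⟨1, one_pos, by simp⟩
      | insert k S hk ih =>
        obtain ⟨ε, hε, h⟩ := ih
        by_cases hck : 0 < c k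
        · refine ⟨min ε (c k), lt_min hε hck, fun i hi h0 => ?_⟩
          rcases Finset.mem_insert.1 hi with rfl | hi
          · exact min_le_right _ _
          · exact (min_le_left _ _).trans (h i hi h0)
        · refine ⟨ε, hε, fun i hi h0 => ?_⟩
          rcases Finset.mem_insert.1 hi with rfl | hi
          · exact absurd h0 hck
          · exact h i hi h0
    obtain ⟨ε, h1, h2⟩ := this Finset.univ
    exact ⟨ε, h1, fun i => h2 i (Finset.mem_univ i)⟩
  obtain ⟨q, hq1, hq2, hq3⟩ := rational_approx c ε hε
  have hqpos : ∀ i, 0 < c i → 0 < q i := by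
    intro i hi
    have h1 := abs_lt.1 (hq1 i)
    have h2 := hεc i hi
    have : (0 : ℝ) < q i := by linarith
    exact_mod_cast this
  have hqnn : ∀ i, 0 ≤ q i := by
    intro i
    rcases (hc i).eq_or_lt with h | h
    · rw [hq2 i h.symm]
    · exact (hqpos i h).le
  have hqle : ∀ i, (q i : ℝ) ≤ 2 * c i := by
    intro i
    rcases (hc i).eq_or_lt with h | h
    · rw [hq2 i h.symm, ← h]; simp
    · have h1 := abs_lt.1 (hq1 i)
      have h2 := hεc i h
      linarith
  let D : ℕ := ∏ i, (q i).den
  have hD : 0 < D := Finset.prod_pos fun i _ => (q i).den_pos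
  have hn : ∀ i, ∃ n : ℕ, (n : ℚ) = D * q i := by
    intro i
    obtain ⟨m, hm⟩ : (q i).den ∣ D := Finset.dvd_prod_of_mem _ (Finset.mem_univ i)
    refine ⟨m * (q i).num.toNat, ?_⟩
    have hnum : (((q i).num.toNat : ℕ) : ℚ) = ((q i).num : ℚ) := by
      have : (((q i).num.toNat : ℕ) : ℤ) = (q i).num :=
        Int.toNat_of_nonneg (Rat.num_nonneg.2 (hqnn i))
      exact_mod_cast this
    have hmul : (q i) * (q i).den = (q i).num := Rat.mul_den_eq_num (q i)
    rw [hm]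
    push_cast
    rw [hnum, ← hmul]
    ring
  choose n hn using hn
  have hnR : ∀ i, (n i : ℝ) = D * (q i : ℝ) := fun i => by exact_mod_cast hn i
  have hDR : (0 : ℝ) < D := by exact_mod_cast hD
  refine ⟨D, n, hD, fun i => ?_, fun i hi => ?_, fun a ha => ?_⟩
  · rw [hnR]
    nlinarith [hqle i]
  · have h1 : (0 : ℝ) < q i := by exact_mod_cast hqpos i hi
    have : (0 : ℝ) < n i := by rw [hnR]; positivity
    exact_mod_cast this
  · have h1 := hq3 a ha
    have h2 : ∑ i, (q i : ℝ) * (a i : ℝ) = 0 := by exact_mod_cast h1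
    calc _ = (D : ℝ) * ∑ i, (q i : ℝ) * (a i : ℝ) := by
          rw [Finset.mul_sum]
          exact Finset.sum_congr rfl fun i _ => by rw [hnR]; ring
      _ = 0 := by rw [h2, mul_zero]

/-- Abstract LP duality, with an integral solution in the rational case. -/
theorem lp_abstract {T ι : Type*} [Fintype T] [DecidableEq T] [Fintype ι] [DecidableEq ι]
    (F : ι → (T → ℝ) →ₗ[ℝ] ℝ) (u v : ι → ℝ) (hv : ∀ i, 0 ≤ v i) (hu : ∀ i, 0 ≤ u i) (opt : ℝ)
    (hcone : ∀ (h : T → ℝ) (t s : ℝ), 0 ≤ s → (∀ i, 0 ≤ F i h - u i * t + v i * s) →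
      t ≤ opt * s)
    (hweak : ∀ b : ℝ, (∀ (h : T → ℝ) (t : ℝ), (∀ i, 0 ≤ F i h - u i * t + v i) → t ≤ b) →
      opt ≤ b) :
    ∃ c : ι → ℝ, (∀ i, 0 ≤ c i) ∧ (∀ h, ∑ i, c i * F i h = 0) ∧ 0 < ∑ i, c i * u i ∧
      ∑ i, c i * v i = opt * ∑ i, c i * u i ∧
      ((∀ i S, ∃ r : ℚ, (r : ℝ) = F i (Pi.single S 1)) → ∀ i, ∃ n : ℕ, (n : ℝ) = c i) := by
  -- weak duality
  have weak : ∀ c : ι → ℝ, (∀ i, 0 ≤ c i) → (∀ h, ∑ i, c i * F i h = 0) →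
      opt * ∑ i, c i * u i ≤ ∑ i, c i * v i := by
    intro c hc hF
    have hcu : 0 ≤ ∑ i, c i * u i := Finset.sum_nonneg fun i _ => mul_nonneg (hc i) (hu i)
    have hcv : 0 ≤ ∑ i, c i * v i := Finset.sum_nonneg fun i _ => mul_nonneg (hc i) (hv i)
    rcases hcu.eq_or_lt with h0 | h0
    · rw [← h0, mul_zero]; exact hcv
    · rw [← le_div_iff₀ h0]
      refine hweak _ fun h t hh => ?_
      rw [le_div_iff₀ h0]
      have h1 : 0 ≤ ∑ i, c i * (F i h - u i * t + v i) :=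
        Finset.sum_nonneg fun i _ => mul_nonneg (hc i) (hh i)
      have h2 : ∑ i, c i * (F i h - u i * t + v i)
          = ∑ i, c i * F i h - t * ∑ i, c i * u i + ∑ i, c i * v i := by
        rw [Finset.mul_sum, ← Finset.sum_sub_distrib, ← Finset.sum_add_distrib]
        exact Finset.sum_congr rfl fun i _ => by ring
      rw [h2, hF h] at h1
      linarith
  -- strong duality
  obtain ⟨c, hc, hF, hcu, hcv⟩ : ∃ c : ι → ℝ, (∀ i, 0 ≤ c i) ∧ (∀ h, ∑ i, c i * F i h = 0) ∧
      ∑ i, c i * u i = 1 ∧ ∑ i, c i * v i = opt * ∑ i, c i * u i := by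
    let pt : ((T → ℝ) × ℝ × ℝ) →ₗ[ℝ] ℝ := LinearMap.fst ℝ ℝ ℝ ∘ₗ LinearMap.snd ℝ (T → ℝ) (ℝ × ℝ)
    let ps : ((T → ℝ) × ℝ × ℝ) →ₗ[ℝ] ℝ := LinearMap.snd ℝ ℝ ℝ ∘ₗ LinearMap.snd ℝ (T → ℝ) (ℝ × ℝ)
    let A : Option ι → ((T → ℝ) × ℝ × ℝ) →ₗ[ℝ] ℝ := fun o =>
      o.elim ps (fun i => (F i) ∘ₗ LinearMap.fst ℝ (T → ℝ) (ℝ × ℝ) - u i • pt + v i • ps)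
    have hA : ∀ i h t s, A (some i) (h, t, s) = F i h - u i * t + v i * s := by
      intro i h t s; simp [A, pt, ps]
    have hA0 : ∀ h t s, A none (h, t, s) = s := by
      intro h t s; simp [A, ps]
    obtain ⟨c, hc, hb⟩ := farkas_aux Finset.univ A (opt • ps - pt) (by
      rintro ⟨h, t, s⟩ hx
      have h1 := hcone h t s (by rw [← hA0 h t s]; exact hx none (Finset.mem_univ _))
        (fun i => by rw [← hA]; exact hx (some i) (Finset.mem_univ _))
      simp [pt, ps]
      linarith)
    have hb' : ∀ h t s, opt * s - t
        = c none * s + ∑ i, c (some i) * (F i h - u i * t + v i * s) := by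
      intro h t s
      have := hb (h, t, s)
      rw [Fintype.sum_option] at this
      simp only [hA, hA0] at this
      simpa [pt, ps] using this
    have hF : ∀ h, ∑ i, c (some i) * F i h = 0 := by
      intro h
      have := hb' h 0 0
      simp at this
      linarith
    have hcu : ∑ i, c (some i) * u i = 1 := by
      have := hb' 0 1 0
      simp at this
      linarith
    refine ⟨fun i => c (some i), fun i => hc _, hF, hcu, le_antisymm ?_ (weak _ (fun i => hc _) hF)⟩
    have := hb' 0 0 1
    simp at this
    rw [hcu]
    linarith [hc none]
  by_cases hrat : ∀ i S, ∃ r : ℚ, (r : ℝ) = F i (Pi.single S 1)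
  swap
  · exact ⟨c, hc, hF, by rw [hcu]; exact one_pos, hcv, fun h => absurd h hrat⟩
  choose r hr using hrat
  obtain ⟨D, n, hD, hn2, hnpos, hnrel⟩ := nat_approx c hc
  have hnF : ∀ h, ∑ i, (n i : ℝ) * F i h = 0 := by
    intro h
    have hdec : ∀ i, F i h = ∑ S, h S * (r i S : ℝ) := by
      intro i
      conv_lhs => rw [← Finset.univ_sum_single h]
      rw [map_sum]
      refine Finset.sum_congr rfl fun S _ => ?_
      rw [hr i S]
      have : (Pi.single S (h S) : T → ℝ) = h S • Pi.single S 1 := by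
        rw [← Pi.single_smul]; simp
      rw [this, map_smul, smul_eq_mul]
    calc _ = ∑ S, h S * ∑ i, (n i : ℝ) * (r i S : ℝ) := by
          simp only [hdec, Finset.mul_sum]
          rw [Finset.sum_comm]
          exact Finset.sum_congr rfl fun S _ => Finset.sum_congr rfl fun i _ => by ring
      _ = 0 := by
          refine Finset.sum_eq_zero fun S _ => ?_
          rw [hnrel (fun i => r i S) (by simp only [hr]; exact hF _), mul_zero]
  refine ⟨fun i => n i, fun i => Nat.cast_nonneg _, hnF, ?_, ?_, fun _ i => ⟨n i, rfl⟩⟩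
  · obtain ⟨i, -, hi⟩ : ∃ i ∈ Finset.univ, 0 < c i * u i := by
      by_contra hcon
      push Not at hcon
      have := Finset.sum_nonpos hcon
      linarith
    have hui : 0 < u i := by
      rcases (hu i).eq_or_lt with h | h
      · rw [← h] at hi; simp at hi
      · exact h
    have hci : 0 < c i := by
      rcases (hc i).eq_or_lt with h | h
      · rw [← h] at hi; simp at hi
      · exact h
    have hni : (0 : ℝ) < n i := by exact_mod_cast hnpos i hci
    exact Finset.sum_pos' (fun i _ => mul_nonneg (Nat.cast_nonneg _) (hu i))
      ⟨i, Finset.mem_univ i, mul_pos hni hui⟩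
  · have h1 := weak (fun i => (n i : ℝ)) (fun i => Nat.cast_nonneg _) hnF
    have h2 := weak (fun i => 2 * (D * c i) - n i) (fun i => by linarith [hn2 i]) (by
      intro h
      have : ∑ i, (2 * (D * c i) - (n i : ℝ)) * F i h
          = 2 * D * ∑ i, c i * F i h - ∑ i, (n i : ℝ) * F i h := by
        rw [Finset.mul_sum, ← Finset.sum_sub_distrib]
        exact Finset.sum_congr rfl fun i _ => by ring
      rw [this, hF, hnF]; ring)
    have h3 : ∀ z : ι → ℝ, ∑ i, (2 * (D * c i) - (n i : ℝ)) * z i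
        = 2 * D * ∑ i, c i * z i - ∑ i, (n i : ℝ) * z i := by
      intro z
      rw [Finset.mul_sum, ← Finset.sum_sub_distrib]
      exact Finset.sum_congr rfl fun i _ => by ring
    rw [h3, h3, hcv] at h2
    refine le_antisymm ?_ h1
    linarith

/-- The conditional term as a linear functional. -/
noncomputable def condHL {V : Type*} [DecidableEq V] (Y X : Finset V) :
    (Finset V → ℝ) →ₗ[ℝ] ℝ where
  toFun h := condH h Y X
  map_add' a b := by simp [condH]; ring
  map_smul' a b := by simp [condH]; ring

/-- The mutual-information term as a linear functional. -/
noncomputable def condMIL {V : Type*} [DecidableEq V] (Y Z X : Finset V) :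
    (Finset V → ℝ) →ₗ[ℝ] ℝ where
  toFun h := condMI h Y Z X
  map_add' a b := by simp [condMI]; ring
  map_smul' a b := by simp [condMI]; ring

theorem rat_condHL {V : Type*} [DecidableEq V] (Y X S : Finset V) :
    ∃ r : ℚ, (r : ℝ) = condHL Y X (Pi.single S 1) := by
  refine ⟨(Pi.single S 1 : Finset V → ℚ) (X ∪ Y) - (Pi.single S 1 : Finset V → ℚ) X, ?_⟩
  simp only [condHL, condH, LinearMap.coe_mk, AddHom.coe_mk, Pi.single_apply, Rat.cast_sub, Rat.cast_add,
    apply_ite (Rat.cast : ℚ → ℝ), Rat.cast_one, Rat.cast_zero]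

theorem rat_condMIL {V : Type*} [DecidableEq V] (Y Z X S : Finset V) :
    ∃ r : ℚ, (r : ℝ) = condMIL Y Z X (Pi.single S 1) := by
  refine ⟨(Pi.single S 1 : Finset V → ℚ) (X ∪ Y) + (Pi.single S 1 : Finset V → ℚ) (X ∪ Z)
    - (Pi.single S 1 : Finset V → ℚ) X - (Pi.single S 1 : Finset V → ℚ) (X ∪ Y ∪ Z), ?_⟩
  simp only [condMIL, condMI, LinearMap.coe_mk, AddHom.coe_mk, Pi.single_apply, Rat.cast_sub, Rat.cast_add,
    apply_ite (Rat.cast : ℚ → ℝ), Rat.cast_one, Rat.cast_zero]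

/-- Nonnegativity of the elemental terms characterises polymatroids after normalisation. -/
theorem poly_of_terms {V : Type*} [DecidableEq V] [Fintype V] (h : Finset V → ℝ)
    (h1 : ∀ Y X, 0 ≤ condH h Y X) (h2 : ∀ Y Z X, 0 ≤ condMI h Y Z X) :
    IsPolymatroid (fun S => h S - h ∅) := by
  refine ⟨by simp, fun A => ?_, fun A B hAB => ?_, fun A B => ?_⟩
  · have := h1 A ∅
    simpa [condH] using this
  · have := h1 B A
    rw [condH, Finset.union_eq_right.2 hAB] at this
    dsimp only
    linarith
  · have := h2 A B (A ∩ B)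
    have e1 : A ∩ B ∪ A = A := Finset.union_eq_right.2 Finset.inter_subset_left
    have e2 : A ∩ B ∪ B = B := Finset.union_eq_right.2 Finset.inter_subset_right
    rw [condMI, e1, e2] at this
    dsimp only
    linarith

theorem condH_nonneg' {V : Type*} [DecidableEq V] [Fintype V] {h : Finset V → ℝ}
    (hp : IsPolymatroid h) (Y X : Finset V) : 0 ≤ condH h Y X := by
  have := hp.2.2.1 X (X ∪ Y) Finset.subset_union_left
  rw [condH]
  linarith

theorem condMI_nonneg' {V : Type*} [DecidableEq V] [Fintype V] {h : Finset V → ℝ}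
    (hp : IsPolymatroid h) (Y Z X : Finset V) : 0 ≤ condMI h Y Z X := by
  have h1 := hp.2.2.2 (X ∪ Y) (X ∪ Z)
  have h2 := hp.2.2.1 X ((X ∪ Y) ∩ (X ∪ Z))
    (Finset.subset_inter Finset.subset_union_left Finset.subset_union_left)
  have e : (X ∪ Y) ∪ (X ∪ Z) = X ∪ Y ∪ Z := by ext; simp; tauto
  rw [e] at h1
  rw [condMI]
  linarith

/-- Under the covering hypothesis a polymatroid with edges bounded by `s` is bounded. -/
theorem poly_bound {V : Type*} [DecidableEq V] [Fintype V] (E : Finset (Finset V))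
    (hcov : ∀ v : V, ∃ e ∈ E, v ∈ e) {h : Finset V → ℝ} (hp : IsPolymatroid h) (s : ℝ)
    (hs : ∀ e ∈ E, h e ≤ s) (A : Finset V) : h A ≤ A.card * s := by
  induction A using Finset.induction_on with
  | empty => simp [hp.1]
  | insert v A hv ih =>
    obtain ⟨e, he, hve⟩ := hcov v
    have h1 : h {v} ≤ s := (hp.2.2.1 _ _ (Finset.singleton_subset_iff.2 hve)).trans (hs e he)
    have h2 := hp.2.2.2 {v} A
    have h3 := hp.2.1 ({v} ∩ A)
    rw [Finset.card_insert_of_notMem hv, Finset.insert_eq]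
    push_cast
    linarith

/-- A priori bound on the LP value. -/
theorem lp_bound {V : Type*} [DecidableEq V] [Fintype V]
    (ω : ℝ) (hω₂ : 2 ≤ ω) (hω₃ : ω ≤ 3)
    (E : Finset (Finset V)) (hcov : ∀ v : V, ∃ e ∈ E, v ∈ e)
    {L J : ℕ} (hLJ : 1 ≤ L + J)
    (U : Fin L → Finset V) (Xj Yj Zj Gj : Fin J → Finset V)
    (h : Finset V → ℝ) (hp : IsPolymatroid h) (s t : ℝ) (hs : 0 ≤ s) (hE : ∀ e ∈ E, h e ≤ s)
    (hU : ∀ ℓ : Fin L, t ≤ h (U ℓ))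
    (hG : ∀ j : Fin J, t ≤ condH h (Xj j) (Gj j) + condH h (Yj j) (Gj j) +
        (ω - 2) * condH h (Zj j) (Gj j) + h (Gj j)) :
    t ≤ (4 * Fintype.card V : ℝ) * s := by
  have hb : ∀ A, h A ≤ Fintype.card V * s := fun A =>
    (poly_bound E hcov hp s hE A).trans
      (mul_le_mul_of_nonneg_right (by exact_mod_cast Finset.card_le_univ A) hs)
  have h0 : 0 ≤ (Fintype.card V : ℝ) * s := by positivity
  have hc : ∀ Y X, condH h Y X ≤ Fintype.card V * s := by
    intro Y X
    have h1 := hb (X ∪ Y)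
    have h2 := hp.2.1 X
    rw [condH]
    linarith
  rcases Nat.eq_zero_or_pos L with hL | hL
  · have hJ : 0 < J := by omega
    have h1 := hG ⟨0, hJ⟩
    have h2 := hc (Xj ⟨0, hJ⟩) (Gj ⟨0, hJ⟩)
    have h3 := hc (Yj ⟨0, hJ⟩) (Gj ⟨0, hJ⟩)
    have h4 := hc (Zj ⟨0, hJ⟩) (Gj ⟨0, hJ⟩)
    have h5 := hb (Gj ⟨0, hJ⟩)
    have h6 : (ω - 2) * condH h (Zj ⟨0, hJ⟩) (Gj ⟨0, hJ⟩) ≤ 1 * (Fintype.card V * s) :=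
      mul_le_mul (by linarith) h4 (condH_nonneg' hp _ _) zero_le_one
    linarith
  · have h1 := hU ⟨0, hL⟩
    have h2 := hb (U ⟨0, hL⟩)
    linarith

theorem poly_smul {V : Type*} [DecidableEq V] [Fintype V] {h : Finset V → ℝ}
    (hp : IsPolymatroid h) (r : ℝ) (hr : 0 ≤ r) : IsPolymatroid (fun S => r * h S) := by
  refine ⟨by simp [hp.1], fun A => mul_nonneg hr (hp.2.1 A),
    fun A B hAB => mul_le_mul_of_nonneg_left (hp.2.2.1 A B hAB) hr, fun A B => ?_⟩
  have := mul_le_mul_of_nonneg_left (hp.2.2.2 A B) hr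
  dsimp only
  linarith

/-- from the inner linear program of the ω-submodular width to a
matching ω-Shannon inequality (via LP duality); if `ω` is rational the
inequality can moreover be chosen integral, with an integer certificate. -/
theorem lp_to_omega_shannon {V : Type*} [DecidableEq V] [Fintype V]
    (ω : ℝ) (hω₂ : 2 ≤ ω) (hω₃ : ω ≤ 3)
    (E : Finset (Finset V)) (hcov : ∀ v : V, ∃ e ∈ E, v ∈ e)
    {L J : ℕ} (hLJ : 1 ≤ L + J)
    (U : Fin L → Finset V)
    (Xj Yj Zj Gj : Fin J → Finset V)
    (hdisj : ∀ j, Disjoint (Xj j) (Yj j) ∧ Disjoint (Xj j) (Zj j) ∧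
      Disjoint (Xj j) (Gj j) ∧ Disjoint (Yj j) (Zj j) ∧
      Disjoint (Yj j) (Gj j) ∧ Disjoint (Zj j) (Gj j))
    (opt : ℝ)
    (hopt : opt = sSup {t : ℝ | ∃ h : Finset V → ℝ, IsPolymatroid h ∧
      (∀ e ∈ E, h e ≤ 1) ∧
      (∀ ℓ : Fin L, t ≤ h (U ℓ)) ∧
      (∀ j : Fin J, t ≤ condH h (Xj j) (Gj j) + condH h (Yj j) (Gj j) +
        (ω - 2) * condH h (Zj j) (Gj j) + h (Gj j))}) :
    ∃ (I : ℕ) (Xi Yi : Fin I → Finset V)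
      (lam : Fin L → ℝ) (α β ζ κ : Fin J → ℝ) (w : Fin I → ℝ),
      -- nonnegative coefficients
      (∀ ℓ, 0 ≤ lam ℓ) ∧ (∀ j, 0 ≤ κ j) ∧ (∀ i, 0 ≤ w i) ∧
      -- dropped groups have all coefficients zero
      (∀ j, κ j = 0 → α j = 0 ∧ β j = 0 ∧ ζ j = 0) ∧
      -- surviving groups have α_j = β_j = κ_j and ζ_j = κ_j·γ
      (∀ j, 0 < κ j → α j = κ j ∧ β j = κ j ∧ ζ j = κ j * (ω - 2)) ∧
      -- right-hand side terms are unconditional and supported on hyperedges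
      (∀ i, Xi i = (∅ : Finset V) ∧ Yi i ∈ E) ∧
      (0 < (∑ ℓ, lam ℓ) + (∑ j, κ j)) ∧
      ((∑ i, w i) / ((∑ ℓ, lam ℓ) + (∑ j, κ j)) = opt) ∧
      -- it is a valid Shannon inequality
      (∀ h : Finset V → ℝ, IsPolymatroid h →
        (∑ ℓ, lam ℓ * h (U ℓ)) +
          (∑ j, (α j * condH h (Xj j) (Gj j) + β j * condH h (Yj j) (Gj j) +
                 ζ j * condH h (Zj j) (Gj j) + κ j * h (Gj j))) ≤
        ∑ i, w i * condH h (Yi i) (Xi i)) ∧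
      -- moreover, if ω is rational the inequality can be chosen integral
      ((∃ q : ℚ, (q : ℝ) = ω) →
        (∀ ℓ, ∃ n : ℕ, (n : ℝ) = lam ℓ) ∧
        (∀ j, (∃ n : ℕ, (n : ℝ) = α j) ∧ (∃ n : ℕ, (n : ℝ) = β j) ∧
          (∃ n : ℕ, (n : ℝ) = ζ j) ∧ (∃ n : ℕ, (n : ℝ) = κ j)) ∧
        (∀ i, ∃ n : ℕ, (n : ℝ) = w i) ∧
        ∃ (P Q : ℕ) (Xp Yp : Fin P → Finset V) (Xq Yq Zq : Fin Q → Finset V)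
          (m : Fin P → ℕ) (s : Fin Q → ℕ),
          ∀ h : Finset V → ℝ, h ∅ = 0 →
            (∑ ℓ, lam ℓ * h (U ℓ)) +
              (∑ j, (α j * condH h (Xj j) (Gj j) + β j * condH h (Yj j) (Gj j) +
                     ζ j * condH h (Zj j) (Gj j) + κ j * h (Gj j))) =
            (∑ i, w i * condH h (Yi i) (Xi i))
              - (∑ p, (m p : ℝ) * condH h (Yp p) (Xp p))
              - (∑ q, (s q : ℝ) * condMI h (Yq q) (Zq q) (Xq q))) := by
  classical
  set SS : Set ℝ := {t : ℝ | ∃ h : Finset V → ℝ, IsPolymatroid h ∧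
      (∀ e ∈ E, h e ≤ 1) ∧
      (∀ ℓ : Fin L, t ≤ h (U ℓ)) ∧
      (∀ j : Fin J, t ≤ condH h (Xj j) (Gj j) + condH h (Yj j) (Gj j) +
        (ω - 2) * condH h (Zj j) (Gj j) + h (Gj j))} with hSS
  have hbdd : BddAbove SS := by
    refine ⟨(4 * Fintype.card V : ℝ) * 1, ?_⟩
    rintro t ⟨h, hp, hE, hU, hG⟩
    exact lp_bound ω hω₂ hω₃ E hcov hLJ U Xj Yj Zj Gj h hp 1 t zero_le_one hE hU hG
  have hne : SS.Nonempty := by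
    refine ⟨0, fun _ => 0, ⟨rfl, fun _ => le_rfl, fun _ _ _ => le_rfl, fun _ _ => le_rfl⟩, ?_⟩
    simp [condH]
  let F : Fin L ⊕ Fin J ⊕ {e // e ∈ E} ⊕ (Finset V × Finset V) ⊕
      (Finset V × Finset V × Finset V) → (Finset V → ℝ) →ₗ[ℝ] ℝ :=
    Sum.elim (fun ℓ => condHL (U ℓ) ∅) (Sum.elim
      (fun j => condHL (Xj j) (Gj j) + condHL (Yj j) (Gj j) + (ω - 2) • condHL (Zj j) (Gj j)
        + condHL (Gj j) ∅)
      (Sum.elim (fun e => -condHL e.1 ∅) (Sum.elim (fun p => condHL p.1 p.2)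
        (fun p => condMIL p.1 p.2.1 p.2.2))))
  let u : Fin L ⊕ Fin J ⊕ {e // e ∈ E} ⊕ (Finset V × Finset V) ⊕
      (Finset V × Finset V × Finset V) → ℝ :=
    Sum.elim (fun _ => 1) (Sum.elim (fun _ => 1) (fun _ => 0))
  let v : Fin L ⊕ Fin J ⊕ {e // e ∈ E} ⊕ (Finset V × Finset V) ⊕
      (Finset V × Finset V × Finset V) → ℝ :=
    Sum.elim (fun _ => 0) (Sum.elim (fun _ => 0) (Sum.elim (fun _ => 1) (fun _ => 0)))
  -- unpacking the constraints of the LP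
  have hfeas : ∀ (h : Finset V → ℝ) (t s : ℝ), (∀ i, 0 ≤ F i h - u i * t + v i * s) →
      ∃ g : Finset V → ℝ, IsPolymatroid g ∧ (∀ e ∈ E, g e ≤ s) ∧ (∀ ℓ : Fin L, t ≤ g (U ℓ)) ∧
      (∀ j : Fin J, t ≤ condH g (Xj j) (Gj j) + condH g (Yj j) (Gj j) +
        (ω - 2) * condH g (Zj j) (Gj j) + g (Gj j)) := by
    intro h t s hi
    refine ⟨fun S => h S - h ∅, poly_of_terms h (fun Y X => ?_) (fun Y Z X => ?_),
      fun e he => ?_, fun ℓ => ?_, fun j => ?_⟩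
    · have := hi (.inr (.inr (.inr (.inl (Y, X)))))
      simpa [F, u, v, condHL] using this
    · have := hi (.inr (.inr (.inr (.inr (Y, Z, X)))))
      simpa [F, u, v, condMIL] using this
    · have := hi (.inr (.inr (.inl ⟨e, he⟩)))
      simp [F, u, v, condHL, condH] at this
      simp only [tsub_le_iff_right]
      linarith
    · have := hi (.inl ℓ)
      simp [F, u, v, condHL, condH] at this
      dsimp only
      linarith
    · have := hi (.inr (.inl j))
      simp [F, u, v, condHL, condH] at this
      simp only [condH]
      linarith
  obtain ⟨c, hc, hcF, hcu, hcv, hint⟩ := lp_abstract F u v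
    (by rintro (i | i | i | i) <;> simp [v]) (by rintro (i | i | i) <;> simp [u]) opt
    (by
      intro h t s hs hi
      obtain ⟨g, hg, hgE, hgU, hgG⟩ := hfeas h t s hi
      rcases hs.eq_or_lt with h0 | h0
      · have := lp_bound ω hω₂ hω₃ E hcov hLJ U Xj Yj Zj Gj g hg s t hs hgE hgU hgG
        rw [← h0] at this ⊢
        simpa using this
      · have hr : 0 < s⁻¹ := inv_pos.2 h0
        have hmem : s⁻¹ * t ∈ SS := by
          refine ⟨fun S => s⁻¹ * g S, poly_smul hg _ hr.le, fun e he => ?_, fun ℓ => ?_,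
            fun j => ?_⟩
          · have := mul_le_mul_of_nonneg_left (hgE e he) hr.le
            rwa [inv_mul_cancel₀ h0.ne'] at this
          · exact mul_le_mul_of_nonneg_left (hgU ℓ) hr.le
          · have := mul_le_mul_of_nonneg_left (hgG j) hr.le
            simp only [condH] at this ⊢
            linarith
        have h1 := le_csSup hbdd hmem
        rw [← hopt] at h1
        rw [inv_mul_le_iff₀ h0] at h1
        linarith)
    (by
      intro b hb
      rw [hopt]
      refine csSup_le hne ?_
      rintro t ⟨h, hp, hE, hU, hG⟩
      refine hb h t ?_
      rintro (ℓ | j | e | p | p)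
      · have := hU ℓ
        simp [F, u, v, condHL, condH, hp.1]
        linarith
      · have := hG j
        simp only [condH] at this
        simp [F, u, v, condHL, condH, hp.1]
        linarith
      · have := hE e.1 e.2
        simp [F, u, v, condHL, condH, hp.1]
        linarith
      · have := condH_nonneg' hp p.1 p.2
        simpa [F, u, v, condHL] using this
      · have := condMI_nonneg' hp p.1 p.2.1 p.2.2
        simpa [F, u, v, condMIL] using this)
  -- a common denominator for `ω - 2`
  obtain ⟨D, hD, hDω⟩ : ∃ D : ℕ, 0 < D ∧
      ((∃ q : ℚ, (q : ℝ) = ω) → ∃ m : ℕ, (m : ℝ) = D * (ω - 2)) := by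
    by_cases hq : ∃ q : ℚ, (q : ℝ) = ω
    · obtain ⟨q, hq⟩ := hq
      have hq2 : 0 ≤ q - 2 := by
        have : (0 : ℝ) ≤ ((q - 2 : ℚ) : ℝ) := by push_cast; linarith
        exact_mod_cast this
      refine ⟨(q - 2).den, (q - 2).den_pos, fun _ => ⟨(q - 2).num.toNat, ?_⟩⟩
      have h1 : (((q - 2).num.toNat : ℕ) : ℤ) = (q - 2).num :=
        Int.toNat_of_nonneg (Rat.num_nonneg.2 hq2)
      have h2 : (((q - 2).num.toNat : ℕ) : ℚ) = (q - 2).den * (q - 2) := by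
        rw [mul_comm, Rat.mul_den_eq_num]
        exact_mod_cast h1
      rw [← hq]
      exact_mod_cast h2
    · exact ⟨1, one_pos, fun h => absurd h hq⟩
  have hDR : (0 : ℝ) < D := by exact_mod_cast hD
  let eE : Fin E.card ≃ {e // e ∈ E} := E.equivFin.symm
  let eP := (Fintype.equivFin (Finset V × Finset V)).symm
  let eQ := (Fintype.equivFin (Finset V × Finset V × Finset V)).symm
  let lam : Fin L → ℝ := fun ℓ => D * c (.inl ℓ)
  let κ : Fin J → ℝ := fun j => D * c (.inr (.inl j))
  let w : Fin E.card → ℝ := fun i => D * c (.inr (.inr (.inl (eE i))))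
  have hnn : ∀ i, 0 ≤ D * c i := fun i => mul_nonneg hDR.le (hc i)
  have hsumu : (∑ ℓ, lam ℓ) + ∑ j, κ j = D * ∑ i, c i * u i := by
    simp [lam, κ, u, Fintype.sum_sum_type, Finset.mul_sum, mul_add]
  have hsumw : ∑ i, w i = D * ∑ i, c i * v i := by
    have h1 : ∑ i, w i = ∑ e, D * c (.inr (.inr (.inl e))) :=
      Equiv.sum_comp eE (fun e => D * c (.inr (.inr (.inl e))))
    rw [h1]
    simp [v, Fintype.sum_sum_type, Finset.mul_sum]
  have hid : ∀ h : Finset V → ℝ, h ∅ = 0 →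
      (∑ ℓ, lam ℓ * h (U ℓ)) +
        (∑ j, (κ j * condH h (Xj j) (Gj j) + κ j * condH h (Yj j) (Gj j) +
               κ j * (ω - 2) * condH h (Zj j) (Gj j) + κ j * h (Gj j))) =
      (∑ i, w i * condH h (eE i).1 ∅)
        - (∑ p, (D * c (.inr (.inr (.inr (.inl (eP p)))))) * condH h (eP p).1 (eP p).2)
        - (∑ q, (D * c (.inr (.inr (.inr (.inr (eQ q)))))) *
            condMI h (eQ q).1 (eQ q).2.1 (eQ q).2.2) := by
    intro h h0
    have h1 : ∑ i, w i * condH h (eE i).1 ∅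
        = ∑ e, (D * c (.inr (.inr (.inl e)))) * condH h e.1 ∅ :=
      Equiv.sum_comp eE (fun e => (D * c (.inr (.inr (.inl e)))) * condH h e.1 ∅)
    have h2 := Equiv.sum_comp eP
      (fun p => (D * c (.inr (.inr (.inr (.inl p))))) * condH h p.1 p.2)
    have h3 := Equiv.sum_comp eQ
      (fun p => (D * c (.inr (.inr (.inr (.inr p))))) * condMI h p.1 p.2.1 p.2.2)
    rw [h1, h2, h3]
    have h4 : (D : ℝ) * ∑ i, c i * F i h = 0 := by rw [hcF h, mul_zero]
    rw [Finset.mul_sum] at h4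
    simp only [Fintype.sum_sum_type] at h4
    have e1 : ∑ ℓ, lam ℓ * h (U ℓ) = ∑ ℓ, (D : ℝ) * (c (.inl ℓ) * F (.inl ℓ) h) := by
      refine Finset.sum_congr rfl fun ℓ _ => ?_
      simp [F, lam, condHL, condH, h0]
      ring
    have e2 : (∑ j, (κ j * condH h (Xj j) (Gj j) + κ j * condH h (Yj j) (Gj j) +
               κ j * (ω - 2) * condH h (Zj j) (Gj j) + κ j * h (Gj j)))
        = ∑ j, (D : ℝ) * (c (.inr (.inl j)) * F (.inr (.inl j)) h) := by
      refine Finset.sum_congr rfl fun j _ => ?_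
      simp [F, κ, condHL, condH, h0]
      ring
    have e3 : ∑ e, (D * c (.inr (.inr (.inl e)))) * condH h e.1 ∅
        = - ∑ e, (D : ℝ) * (c (.inr (.inr (.inl e))) * F (.inr (.inr (.inl e))) h) := by
      rw [← Finset.sum_neg_distrib]
      refine Finset.sum_congr rfl fun j _ => ?_
      simp [F, condHL]
      ring
    have e4 : ∑ p, (D * c (.inr (.inr (.inr (.inl p))))) * condH h p.1 p.2
        = ∑ p, (D : ℝ) * (c (.inr (.inr (.inr (.inl p)))) * F (.inr (.inr (.inr (.inl p)))) h) := by
      refine Finset.sum_congr rfl fun j _ => ?_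
      simp [F, condHL]
      ring
    have e5 : ∑ p, (D * c (.inr (.inr (.inr (.inr p))))) * condMI h p.1 p.2.1 p.2.2
        = ∑ p, (D : ℝ) * (c (.inr (.inr (.inr (.inr p)))) * F (.inr (.inr (.inr (.inr p)))) h) := by
      refine Finset.sum_congr rfl fun j _ => ?_
      simp [F, condMIL]
      ring
    rw [e1, e2, e3, e4, e5]
    linarith
  refine ⟨E.card, fun _ => ∅, fun i => (eE i).1, lam, κ, κ, fun j => κ j * (ω - 2), κ, w,
    fun ℓ => hnn _, fun j => hnn _, fun i => hnn _, fun j hj => ⟨hj, hj, by simp [hj]⟩,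
    fun j _ => ⟨rfl, rfl, rfl⟩, fun i => ⟨rfl, (eE i).2⟩, ?_, ?_, fun h hp => ?_, fun hq => ?_⟩
  · rw [hsumu]; positivity
  · rw [hsumu, hsumw, hcv]
    field_simp
  · rw [hid h hp.1]
    have h1 : 0 ≤ ∑ p, (D * c (.inr (.inr (.inr (.inl (eP p)))))) * condH h (eP p).1 (eP p).2 :=
      Finset.sum_nonneg fun p _ => mul_nonneg (hnn _) (condH_nonneg' hp _ _)
    have h2 : 0 ≤ ∑ q, (D * c (.inr (.inr (.inr (.inr (eQ q)))))) *
            condMI h (eQ q).1 (eQ q).2.1 (eQ q).2.2 :=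
      Finset.sum_nonneg fun p _ => mul_nonneg (hnn _) (condMI_nonneg' hp _ _ _)
    linarith
  · have hn := hint (by
      obtain ⟨q, hq⟩ := hq
      rintro (ℓ | j | e | p | p) S
      · exact rat_condHL _ _ _
      · obtain ⟨r1, h1⟩ := rat_condHL (Xj j) (Gj j) S
        obtain ⟨r2, h2⟩ := rat_condHL (Yj j) (Gj j) S
        obtain ⟨r3, h3⟩ := rat_condHL (Zj j) (Gj j) S
        obtain ⟨r4, h4⟩ := rat_condHL (Gj j) ∅ S
        refine ⟨r1 + r2 + (q - 2) * r3 + r4, ?_⟩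
        push_cast
        rw [h1, h2, h3, h4, hq]
        simp [F]
      · obtain ⟨r1, h1⟩ := rat_condHL e.1 ∅ S
        refine ⟨-r1, ?_⟩
        push_cast
        rw [h1]
        simp [F]
      · exact rat_condHL _ _ _
      · exact rat_condMIL _ _ _ _)
    choose n hn using hn
    obtain ⟨m, hm⟩ := hDω hq
    have hDn : ∀ i, ∃ k : ℕ, (k : ℝ) = D * c i := fun i => ⟨D * n i, by push_cast; rw [hn]⟩
    refine ⟨fun ℓ => hDn _, fun j => ⟨hDn _, hDn _, ⟨m * n (.inr (.inl j)), ?_⟩, hDn _⟩,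
      fun i => hDn _, _, _, fun p => (eP p).2, fun p => (eP p).1, fun q => (eQ q).2.2,
      fun q => (eQ q).1, fun q => (eQ q).2.1,
      fun p => D * n (.inr (.inr (.inr (.inl (eP p))))),
      fun q => D * n (.inr (.inr (.inr (.inr (eQ q))))), fun h h0 => ?_⟩
    · push_cast
      rw [hm, hn]
      simp only [κ]
      ring
    · rw [hid h h0]
      push_cast
      simp only [hn]
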